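/- Lemma 3 (converse, regime P ≤ (K−M)/2). Under the PIR-with-private-side-information setup, with S = {1,…,M}, demand set 𝒫 = {M+1,…,M+P}, and A_1 = A_1^{S,𝒫}, if P ≤ (K−M)/2 then (K−M)·L ≤ N·H(A_1 | Q, W_S) + (N−1)·[N·H(A_1 | Q, W_S) − P·L] + (K−M−2P)·L − H(A_1 | W_{M+1},…,W_{M+2P}, Q, W_S). -/

import Mathlib

open scoped BigOperators

/-- Probability that random variable `X` takes the value `x`, under the
probability mass function `p` on the finite sample space `Ω`. -/
noncomputable def pr {Ω : Type} [Fintype Ω] (p : Ω → ℝ) {α : Type} [DecidableEq α]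
    (X : Ω → α) (x : α) : ℝ :=
  ∑ ω ∈ Finset.univ.filter (fun ω => X ω = x), p ω

/-- Shannon entropy of `X` in base `b` (with the convention `0 * log 0 = 0`). -/
noncomputable def ent {Ω : Type} [Fintype Ω] (b : ℝ) (p : Ω → ℝ) {α : Type} [Fintype α]
    [DecidableEq α] (X : Ω → α) : ℝ :=
  -∑ x : α, pr p X x * Real.logb b (pr p X x)

/-- Conditional entropy `H(X ∣ Y) = H(X, Y) - H(Y)`, in base `b`. -/
noncomputable def condEnt {Ω : Type} [Fintype Ω] (b : ℝ) (p : Ω → ℝ) {α β : Type} [Fintype α]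
    [DecidableEq α] [Fintype β] [DecidableEq β] (X : Ω → α) (Y : Ω → β) : ℝ :=
  ent b p (fun ω => (X ω, Y ω)) - ent b p Y

/-- `X` is a deterministic function of `Y`. -/
def detFn {Ω α β : Type} (X : Ω → α) (Y : Ω → β) : Prop :=
  ∃ f : β → α, ∀ ω, X ω = f (Y ω)

/-- Admissible demand sets: subsets of `{1,…,K} \ S` of size `P`
(indices are `0`-based, and `S = {1,…,M}` corresponds to indices `< M`). -/
def demands (K M P : ℕ) : Finset (Finset (Fin K)) :=
  Finset.univ.filter (fun T => T.card = P ∧ ∀ i ∈ T, M ≤ i.val)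

section Entropy

variable {Ω : Type} [Fintype Ω] {p : Ω → ℝ}
  {α : Type} [DecidableEq α] {β : Type} [DecidableEq β] {γ : Type} [DecidableEq γ]

lemma pr_nonneg (hp : ∀ ω, 0 ≤ p ω) (X : Ω → α) (x : α) : 0 ≤ pr p X x :=
  Finset.sum_nonneg fun ω _ => hp ω

lemma le_pr_self (hp : ∀ ω, 0 ≤ p ω) (X : Ω → α) (ω : Ω) : p ω ≤ pr p X (X ω) :=
  Finset.single_le_sum (fun ω _ => hp ω) (by simp)

variable [Fintype α]

lemma sum_pr_mul (X : Ω → α) (g : α → ℝ) : ∑ x, pr p X x * g x = ∑ ω, p ω * g (X ω) := by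
  rw [← Finset.sum_fiberwise Finset.univ X]
  refine Finset.sum_congr rfl fun x _ => ?_
  rw [pr, Finset.sum_mul]
  refine Finset.sum_congr rfl fun ω hω => ?_
  rw [(Finset.mem_filter.1 hω).2]

lemma sum_pr_pair (X : Ω → α) (Z : Ω → γ) (z : γ) :
    ∑ x, pr p (fun ω => (X ω, Z ω)) (x, z) = pr p Z z := by
  simp only [pr, Finset.sum_filter, Prod.mk.injEq, ite_and]
  rw [Finset.sum_comm]
  simp

lemma ent_eq_sum (b : ℝ) (X : Ω → α) :
    ent b p X = -∑ ω, p ω * Real.logb b (pr p X (X ω)) := by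
  rw [ent, sum_pr_mul X fun x => Real.logb b (pr p X x)]

lemma pr_restrict_of_uniform {ι : Type} [Fintype ι] [DecidableEq ι] [Nonempty α]
    (W : ι → Ω → α) (Q : Ω → β)
    (h : ∀ w q, pr p (fun ω => ((fun i => W i ω), Q ω)) (w, q)
      = ((Fintype.card α : ℝ) ^ Fintype.card ι)⁻¹ * pr p Q q)
    (T : Finset ι) (w : ↥T → α) (q : β) :
    pr p (fun ω => (Q ω, (fun i : ↥T => W i ω))) (q, w)
      = ((Fintype.card α : ℝ) ^ T.card)⁻¹ * pr p Q q := by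
  set s : Finset (ι → α) :=
    Fintype.piFinset fun i => if hi : i ∈ T then {w ⟨i, hi⟩} else Finset.univ with hs
  have hmem : ∀ f : ι → α, f ∈ s ↔ (fun i : ↥T => f i) = w := by
    intro f
    rw [hs, Fintype.mem_piFinset, funext_iff]
    constructor
    · intro hf i
      simpa using hf i
    · intro hf i
      by_cases hi : i ∈ T
      · simpa [hi] using hf ⟨i, hi⟩
      · simp [hi]
  have hcard : s.card = Fintype.card α ^ (Fintype.card ι - T.card) := by
    rw [hs, Fintype.card_piFinset]
    have : ∀ i, (if hi : i ∈ T then {w ⟨i, hi⟩} else Finset.univ : Finset α).card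
        = if i ∈ T then 1 else Fintype.card α := by
      intro i
      by_cases hi : i ∈ T <;> simp [hi]
    simp only [this]
    rw [Finset.prod_ite, Finset.prod_const_one, one_mul, Finset.prod_const,
      Finset.filter_not, Finset.filter_mem_eq_inter, Finset.univ_inter,
      Finset.card_univ_sdiff]
  have hsum : pr p (fun ω => (Q ω, (fun i : ↥T => W i ω))) (q, w)
      = ∑ f ∈ s, pr p (fun ω => ((fun i => W i ω), Q ω)) (f, q) := by
    simp only [pr, Finset.sum_filter, Prod.mk.injEq, ite_and]
    rw [Finset.sum_comm]
    refine Finset.sum_congr rfl fun ω _ => ?_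
    by_cases h1 : Q ω = q <;> simp [h1, hmem]
  have hα : (Fintype.card α : ℝ) ≠ 0 := by exact_mod_cast Fintype.card_ne_zero
  have hpow : (Fintype.card α : ℝ) ^ Fintype.card ι
      = Fintype.card α ^ (Fintype.card ι - T.card) * Fintype.card α ^ T.card := by
    rw [← pow_add, Nat.sub_add_cancel (Finset.card_le_univ T)]
  rw [hsum, Finset.sum_congr rfl fun f _ => h f q, Finset.sum_const, hcard, nsmul_eq_mul, hpow]
  push_cast
  field_simp

variable [Fintype β]

lemma ent_le_of_factors {b : ℝ} (hb : 1 < b) (hp : ∀ ω, 0 ≤ p ω) {X : Ω → α} {Y : Ω → β}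
    (h : ∀ ω ω', Y ω = Y ω' → X ω = X ω') : ent b p X ≤ ent b p Y := by
  rw [ent_eq_sum, ent_eq_sum, neg_le_neg_iff]
  refine Finset.sum_le_sum fun ω _ => ?_
  rcases (hp ω).eq_or_lt with h0 | h0
  · simp [← h0]
  refine mul_le_mul_of_nonneg_left ?_ (hp ω)
  refine Real.logb_le_logb_of_le hb (h0.trans_le (le_pr_self hp Y ω)) ?_
  refine Finset.sum_le_sum_of_subset_of_nonneg ?_ fun ω _ _ => hp ω
  intro ω' hω'
  simp only [Finset.mem_filter, Finset.mem_univ, true_and] at hω' ⊢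
  exact h _ _ hω'

variable [Fintype γ]

lemma condEnt_congr_right {b : ℝ} (hb : 1 < b) (hp : ∀ ω, 0 ≤ p ω) (X : Ω → α)
    {Y : Ω → β} {Z : Ω → γ} (h : ∀ ω ω', Y ω = Y ω' ↔ Z ω = Z ω') :
    condEnt b p X Y = condEnt b p X Z := by
  refine congrArg₂ (fun x y : ℝ => x - y) (le_antisymm ?_ ?_) (le_antisymm ?_ ?_) <;>
    refine ent_le_of_factors hb hp fun ω ω' => ?_
  · simpa only [Prod.mk.injEq] using And.imp_right (h ω ω').2
  · simpa only [Prod.mk.injEq] using And.imp_right (h ω ω').1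
  · exact (h ω ω').2
  · exact (h ω ω').1

lemma sum_ratio_le_one (hp : ∀ ω, 0 ≤ p ω) (hp1 : ∑ ω, p ω = 1)
    (X : Ω → α) (Y : Ω → β) (Z : Ω → γ) :
    ∑ ω, p ω * (pr p (fun ω => (X ω, Z ω)) (X ω, Z ω) * pr p (fun ω => (Y ω, Z ω)) (Y ω, Z ω)
      / (pr p (fun ω => (X ω, Y ω, Z ω)) (X ω, Y ω, Z ω) * pr p Z (Z ω))) ≤ 1 := by
  set r : α × β × γ → ℝ := pr p (fun ω => (X ω, Y ω, Z ω))
  set u : α × γ → ℝ := pr p (fun ω => (X ω, Z ω)) with hu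
  set v : β × γ → ℝ := pr p (fun ω => (Y ω, Z ω)) with hv
  set c : γ → ℝ := pr p Z
  have hr : ∀ t, 0 ≤ r t := pr_nonneg hp _
  have hc : ∀ t, 0 ≤ c t := pr_nonneg hp _
  have hunn : ∀ t, 0 ≤ u t := pr_nonneg hp _
  have hvnn : ∀ t, 0 ≤ v t := pr_nonneg hp _
  calc _ = ∑ t : α × β × γ, r t * (u (t.1, t.2.2) * v t.2 / (r t * c t.2.2)) :=
        (sum_pr_mul (fun ω => (X ω, Y ω, Z ω))
          fun t => u (t.1, t.2.2) * v t.2 / (r t * c t.2.2)).symm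
    _ ≤ ∑ t : α × β × γ, u (t.1, t.2.2) * v t.2 / c t.2.2 := by
        refine Finset.sum_le_sum fun t _ => ?_
        rcases (hr t).eq_or_lt with h0 | h0
        · rw [← h0, zero_mul]
          exact div_nonneg (mul_nonneg (hunn _) (hvnn _)) (hc _)
        · rw [mul_div_mul_comm, ← mul_assoc, ← mul_div_assoc, mul_div_assoc (u _)]
          apply le_of_eq
          field_simp
    _ = ∑ z, c z * c z / c z := by
        simp only [Fintype.sum_prod_type]
        rw [Finset.sum_congr rfl fun x _ => Finset.sum_comm, Finset.sum_comm]
        refine Finset.sum_congr rfl fun z _ => ?_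
        simp only [← Finset.sum_div, ← Finset.mul_sum, ← Finset.sum_mul]
        rw [hu, hv, sum_pr_pair, sum_pr_pair]
    _ = ∑ z, c z := by simp
    _ = 1 := by
        have := sum_pr_mul (p := p) Z fun _ => 1
        simpa [hp1] using this
    _ ≤ 1 := le_rfl

lemma ent_submodular {b : ℝ} (hb : 1 < b) (hp : ∀ ω, 0 ≤ p ω) (hp1 : ∑ ω, p ω = 1)
    (X : Ω → α) (Y : Ω → β) (Z : Ω → γ) :
    ent b p (fun ω => (X ω, Y ω, Z ω)) + ent b p Z
      ≤ ent b p (fun ω => (X ω, Z ω)) + ent b p (fun ω => (Y ω, Z ω)) := by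
  have hlog : 0 < Real.log b := Real.log_pos hb
  have key : ∀ ω, p ω * (Real.log (pr p (fun ω => (X ω, Z ω)) (X ω, Z ω))
      + Real.log (pr p (fun ω => (Y ω, Z ω)) (Y ω, Z ω))
      - Real.log (pr p (fun ω => (X ω, Y ω, Z ω)) (X ω, Y ω, Z ω))
      - Real.log (pr p Z (Z ω)))
      ≤ p ω * (pr p (fun ω => (X ω, Z ω)) (X ω, Z ω) * pr p (fun ω => (Y ω, Z ω)) (Y ω, Z ω)
      / (pr p (fun ω => (X ω, Y ω, Z ω)) (X ω, Y ω, Z ω) * pr p Z (Z ω))) - p ω := by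
    intro ω
    rcases (hp ω).eq_or_lt with h0 | h0
    · simp [← h0]
    have h1 := h0.trans_le (le_pr_self hp (fun ω => (X ω, Z ω)) ω)
    have h2 := h0.trans_le (le_pr_self hp (fun ω => (Y ω, Z ω)) ω)
    have h3 := h0.trans_le (le_pr_self hp (fun ω => (X ω, Y ω, Z ω)) ω)
    have h4 := h0.trans_le (le_pr_self hp Z ω)
    have h5 := Real.log_le_sub_one_of_pos (div_pos (mul_pos h1 h2) (mul_pos h3 h4))
    rw [Real.log_div (mul_pos h1 h2).ne' (mul_pos h3 h4).ne', Real.log_mul h1.ne' h2.ne',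
      Real.log_mul h3.ne' h4.ne'] at h5
    rw [← mul_sub_one]
    exact mul_le_mul_of_nonneg_left (by linarith) h0.le
  have hsum := Finset.sum_le_sum fun ω (_ : ω ∈ Finset.univ) => key ω
  have hle := sum_ratio_le_one hp hp1 X Y Z
  rw [Finset.sum_sub_distrib, hp1] at hsum
  simp only [mul_add, mul_sub, Finset.sum_add_distrib, Finset.sum_sub_distrib] at hsum
  simp only [ent_eq_sum, Real.logb, ← mul_div_assoc, ← Finset.sum_div]
  rw [← neg_div, ← neg_div, ← neg_div, ← neg_div, ← add_div, ← add_div]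
  exact div_le_div_of_nonneg_right (by linarith) hlog.le

lemma condEnt_pi_le_sum {b : ℝ} (hb : 1 < b) (hp : ∀ ω, 0 ≤ p ω) (hp1 : ∑ ω, p ω = 1)
    {ι : Type} [Fintype ι] [DecidableEq ι] (A : ι → Ω → α) (Y : Ω → β) :
    condEnt b p (fun ω i => A i ω) Y ≤ ∑ i, condEnt b p (A i) Y := by
  have key : ∀ s : Finset ι,
      condEnt b p (fun ω (i : ↥s) => A i ω) Y ≤ ∑ i ∈ s, condEnt b p (A i) Y := by
    intro s
    induction s using Finset.induction_on with
    | empty =>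
      rw [Finset.sum_empty, condEnt, sub_nonpos]
      exact ent_le_of_factors hb hp fun ω ω' h =>
        Prod.ext (funext fun i => absurd i.2 (Finset.notMem_empty _)) h
    | insert a s ha ih =>
      rw [Finset.sum_insert ha]
      have h1 := ent_submodular hb hp hp1 (A a) (fun ω (i : ↥s) => A i ω) Y
      have h2 : ent b p (fun ω => ((fun i : ↥(insert a s) => A i ω), Y ω))
          ≤ ent b p (fun ω => (A a ω, (fun i : ↥s => A i ω), Y ω)) := by
        refine ent_le_of_factors hb hp fun ω ω' h => ?_
        simp only [Prod.mk.injEq] at h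
        obtain ⟨ha, hs, hY⟩ := h
        refine Prod.ext (funext fun i => ?_) hY
        rcases Finset.mem_insert.1 i.2 with hi | hi
        · simpa [hi] using ha
        · exact congrFun hs ⟨i, hi⟩
      simp only [condEnt] at ih ⊢
      linarith
  refine le_trans (sub_le_sub_right (ent_le_of_factors hb hp fun ω ω' h => ?_) _)
    (key Finset.univ)
  simp only [Prod.mk.injEq] at h
  exact Prod.ext (funext fun i => congrFun h.1 ⟨i, Finset.mem_univ i⟩) h.2

lemma ent_restrict_of_uniform {b : ℝ} (hp : ∀ ω, 0 ≤ p ω) (hp1 : ∑ ω, p ω = 1)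
    {ι : Type} [Fintype ι] [DecidableEq ι] [Nonempty α] (W : ι → Ω → α) (Q : Ω → β)
    (h : ∀ w q, pr p (fun ω => ((fun i => W i ω), Q ω)) (w, q)
      = ((Fintype.card α : ℝ) ^ Fintype.card ι)⁻¹ * pr p Q q) (T : Finset ι) :
    ent b p (fun ω => (Q ω, (fun i : ↥T => W i ω)))
      = T.card * Real.logb b (Fintype.card α) + ent b p Q := by
  have hα : (Fintype.card α : ℝ) ≠ 0 := by exact_mod_cast Fintype.card_ne_zero
  have key : ∀ ω, p ω * Real.logb b
        (pr p (fun ω => (Q ω, (fun i : ↥T => W i ω))) (Q ω, (fun i : ↥T => W i ω)))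
      = p ω * Real.logb b (pr p Q (Q ω)) - p ω * (T.card * Real.logb b (Fintype.card α)) := by
    intro ω
    rcases (hp ω).eq_or_lt with h0 | h0
    · simp [← h0]
    rw [pr_restrict_of_uniform W Q h,
      Real.logb_mul (inv_ne_zero (pow_ne_zero _ hα)) (h0.trans_le (le_pr_self hp Q ω)).ne',
      Real.logb_inv, Real.logb_pow]
    ring
  rw [ent_eq_sum, ent_eq_sum, Finset.sum_congr rfl fun ω _ => key ω, Finset.sum_sub_distrib,
    ← Finset.sum_mul, hp1]
  ring

end Entropy

/-- Lemma 3 of the paper (converse, regime `P ≤ (K-M)/2`):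
`(K-M)·L ≤ N·H(A₁ ∣ Q, W_S) + (N-1)·[N·H(A₁ ∣ Q, W_S) - P·L] + (K-M-2P)·L
  - H(A₁ ∣ W_{M+1},…,W_{M+2P}, Q, W_S)`. -/
theorem lemma3_converse_low_P
    (F : Type) [Field F] [Fintype F] [DecidableEq F]
    (QT AT : Type) [Fintype QT] [DecidableEq QT] [Fintype AT] [DecidableEq AT]
    (Ω : Type) [Fintype Ω]
    (p : Ω → ℝ) (hp0 : ∀ ω, 0 ≤ p ω) (hp1 : ∑ ω, p ω = 1)
    (N K L M P : ℕ) (hN : 0 < N) (hMPK : M + P ≤ K)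
    (W : Fin K → Ω → (Fin L → F))
    (Qu : ↥(demands K M P) → Fin N → Ω → QT)
    (A : ↥(demands K M P) → Fin N → Ω → AT)
    (Qall : Ω → (↥(demands K M P) → Fin N → QT))
    (hQall : Qall = fun ω d n => Qu d n ω)
    (S : Finset (Fin K)) (hS : S = Finset.univ.filter (fun i => i.val < M))
    (Pd : Finset (Fin K))
    (hPdDef : Pd = Finset.univ.filter (fun i => M ≤ i.val ∧ i.val < M + P))
    (hPd : Pd ∈ demands K M P)
    -- the files are i.i.d. uniform on `F^L` and independent of all the queries
    (hUnif : ∀ (w : Fin K → Fin L → F) (q : ↥(demands K M P) → Fin N → QT),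
      pr p (fun ω => ((fun i => W i ω), Qall ω)) (w, q)
        = ((Fintype.card F : ℝ) ^ (K * L))⁻¹ * pr p Qall q)
    -- each answer is a deterministic function of the library and the received query
    (hAns : ∀ (d : ↥(demands K M P)) (n : Fin N),
      detFn (A d n) (fun ω => ((fun i => W i ω), Qu d n ω)))
    -- decodability
    (hDec : ∀ d : ↥(demands K M P),
      detFn (fun ω => (fun i : ↥(d : Finset (Fin K)) => W i.val ω))
        (fun ω => ((fun n => A d n ω), Qall ω, (fun i : ↥S => W i.val ω))))
    -- privacy/symmetry (i)
    (hSym : ∀ (n : Fin N) (d d' : ↥(demands K M P)) (T : Finset (Fin K)),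
      condEnt (Fintype.card F) p (A d n)
          (fun ω => (Qall ω, (fun i : ↥T => W i.val ω)))
        = condEnt (Fintype.card F) p (A d' ⟨0, hN⟩)
          (fun ω => (Qall ω, (fun i : ↥T => W i.val ω))))
    -- privacy/symmetry (ii)
    (hMix : ∀ (n : Fin N) (d d' : ↥(demands K M P)),
      detFn (fun ω => (fun i : ↥(d : Finset (Fin K)) => W i.val ω))
        (fun ω => ((fun m : Fin N => if m = n then A d' n ω else A d m ω),
          Qall ω, (fun i : ↥S => W i.val ω))))
    (hReg : (P : ℝ) ≤ ((K : ℝ) - M) / 2)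
    (T2 : Finset (Fin K))
    (hT2 : T2 = Finset.univ.filter (fun i => M ≤ i.val ∧ i.val < M + 2 * P)) :
    ((K : ℝ) - M) * L
      ≤ (N : ℝ) * condEnt (Fintype.card F) p (A ⟨Pd, hPd⟩ ⟨0, hN⟩)
            (fun ω => (Qall ω, (fun i : ↥S => W i.val ω)))
        + ((N : ℝ) - 1) *
            ((N : ℝ) * condEnt (Fintype.card F) p (A ⟨Pd, hPd⟩ ⟨0, hN⟩)
                (fun ω => (Qall ω, (fun i : ↥S => W i.val ω)))
              - (P : ℝ) * L)
        + ((K : ℝ) - M - 2 * P) * L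
        - condEnt (Fintype.card F) p (A ⟨Pd, hPd⟩ ⟨0, hN⟩)
            (fun ω => ((fun i : ↥T2 => W i.val ω), Qall ω, (fun i : ↥S => W i.val ω))) := by
  classical
  have hb : (1 : ℝ) < Fintype.card F := by exact_mod_cast Fintype.one_lt_card
  have hcardW : ∀ T : Finset (Fin K),
      ent (Fintype.card F) p (fun ω => (Qall ω, (fun i : ↥T => W i.val ω)))
        = T.card * L + ent (Fintype.card F) p Qall := by
    intro T
    have h := ent_restrict_of_uniform (b := Fintype.card F) hp0 hp1 W Qall
      (by intro w q; rw [hUnif]; simp [← pow_mul, mul_comm]) T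
    rw [h]
    simp [Real.logb_pow, Real.logb_self_eq_one hb]
  have hKM : M + 2 * P ≤ K := by
    have : ((M + 2 * P : ℕ) : ℝ) ≤ K := by push_cast; linarith
    exact_mod_cast this
  set D : ↥(demands K M P) := ⟨Pd, hPd⟩
  set P2 : Finset (Fin K) := T2 \ Pd with hP2
  have hPdCard : Pd.card = P := (Finset.mem_filter.1 hPd).2.1
  have hT2Card : T2.card = 2 * P := by
    have : T2.map Fin.valEmbedding = Finset.Ico M (M + 2 * P) := by
      ext i
      simp only [hT2, Finset.mem_map, Finset.mem_filter, Finset.mem_univ, true_and,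
        Fin.valEmbedding_apply, Finset.mem_Ico]
      exact ⟨by rintro ⟨a, ha, rfl⟩; exact ha, fun hi => ⟨⟨i, by omega⟩, hi, rfl⟩⟩
    rw [← Finset.card_map Fin.valEmbedding, this, Nat.card_Ico]
    omega
  have hPdT2 : Pd ⊆ T2 := by
    intro i
    simp only [hPdDef, hT2, Finset.mem_filter, Finset.mem_univ, true_and]
    omega
  have hP2Mem : P2 ∈ demands K M P := by
    refine Finset.mem_filter.2 ⟨Finset.mem_univ _, ?_, ?_⟩
    · rw [hP2, Finset.card_sdiff_of_subset hPdT2]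
      omega
    · intro i hi
      rw [hP2, hT2] at hi
      exact (Finset.mem_filter.1 (Finset.mem_sdiff.1 hi).1).2.1
  have hST2 : Disjoint S T2 := by
    rw [Finset.disjoint_left]
    intro i
    simp only [hS, hT2, Finset.mem_filter, Finset.mem_univ, true_and]
    omega
  have hSPdCard : (S ∪ Pd).card = S.card + P := by
    rw [Finset.card_union_of_disjoint (hST2.mono_right hPdT2), hPdCard]
  have hdec : ∀ (d : ↥(demands K M P)) (U V : Finset (Fin K)), S ⊆ U → V ⊆ U ∪ d →
      ent (Fintype.card F) p
          (fun ω => ((fun n => A d n ω), Qall ω, (fun i : ↥V => W i.val ω)))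
        ≤ ent (Fintype.card F) p
          (fun ω => ((fun n => A d n ω), Qall ω, (fun i : ↥U => W i.val ω))) := by
    intro d U V hSU hV
    obtain ⟨f, hf⟩ := hDec d
    refine ent_le_of_factors hb hp0 fun ω ω' h => ?_
    simp only [Prod.mk.injEq] at h ⊢
    obtain ⟨hA, hQ, hW⟩ := h
    refine ⟨hA, hQ, funext fun i => ?_⟩
    rcases Finset.mem_union.1 (hV i.2) with hi | hi
    · exact congrFun hW ⟨i, hi⟩
    · have hWS : (fun i : ↥S => W i.val ω) = fun i : ↥S => W i.val ω' :=
        funext fun j => congrFun hW ⟨j, hSU j.2⟩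
      have hWd : (fun i : ↥(d : Finset (Fin K)) => W i.val ω)
          = fun i : ↥(d : Finset (Fin K)) => W i.val ω' := by
        refine (hf ω).trans (Eq.trans ?_ (hf ω').symm)
        exact congrArg f (Prod.ext hA (Prod.ext hQ hWS))
      exact congrFun hWd ⟨i, hi⟩
  have hsingle : ∀ (d : ↥(demands K M P)) (U : Finset (Fin K)),
      ent (Fintype.card F) p (fun ω => (A d ⟨0, hN⟩ ω, Qall ω, (fun i : ↥U => W i.val ω)))
        ≤ ent (Fintype.card F) p
          (fun ω => ((fun n => A d n ω), Qall ω, (fun i : ↥U => W i.val ω))) := by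
    intro d U
    refine ent_le_of_factors hb hp0 fun ω ω' h => ?_
    simp only [Prod.mk.injEq] at h ⊢
    exact ⟨congrFun h.1 _, h.2⟩
  have hsub : ∀ (d : ↥(demands K M P)) (U : Finset (Fin K)),
      condEnt (Fintype.card F) p (fun ω n => A d n ω)
          (fun ω => (Qall ω, (fun i : ↥U => W i.val ω)))
        ≤ N * condEnt (Fintype.card F) p (A D ⟨0, hN⟩)
          (fun ω => (Qall ω, (fun i : ↥U => W i.val ω))) := by
    intro d U
    refine (condEnt_pi_le_sum hb hp0 hp1 (fun n => A d n) _).trans_eq ?_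
    rw [Finset.sum_congr rfl fun n _ => hSym n d D U]
    simp
  have hlast : condEnt (Fintype.card F) p (A D ⟨0, hN⟩)
        (fun ω => ((fun i : ↥T2 => W i.val ω), Qall ω, (fun i : ↥S => W i.val ω)))
      = condEnt (Fintype.card F) p (A ⟨P2, hP2Mem⟩ ⟨0, hN⟩)
        (fun ω => (Qall ω, (fun i : ↥(S ∪ T2) => W i.val ω))) := by
    refine Eq.trans ?_ (hSym ⟨0, hN⟩ D ⟨P2, hP2Mem⟩ (S ∪ T2))
    refine condEnt_congr_right hb hp0 _ fun ω ω' => ⟨fun h => ?_, fun h => ?_⟩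
    · simp only [Prod.mk.injEq] at h ⊢
      refine ⟨h.2.1, funext fun i => ?_⟩
      rcases Finset.mem_union.1 i.2 with hi | hi
      · exact congrFun h.2.2 ⟨i, hi⟩
      · exact congrFun h.1 ⟨i, hi⟩
    · simp only [Prod.mk.injEq] at h ⊢
      exact ⟨funext fun i => congrFun h.2 ⟨i, Finset.mem_union_right _ i.2⟩, h.1,
        funext fun i => congrFun h.2 ⟨i, Finset.mem_union_left _ i.2⟩⟩
  have hSumS := hsub D S
  have hDecPd := hdec D S (S ∪ Pd) subset_rfl subset_rfl
  have hSinglePd := hsingle D (S ∪ Pd)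
  have hSumPd := hsub ⟨P2, hP2Mem⟩ (S ∪ Pd)
  have hDecP2 := hdec ⟨P2, hP2Mem⟩ (S ∪ Pd) (S ∪ T2) Finset.subset_union_left (by
    intro i
    simp only [hP2, Finset.mem_union, Finset.mem_sdiff]
    tauto)
  have hSingleT2 := hsingle ⟨P2, hP2Mem⟩ (S ∪ T2)
  have hcS := hcardW S
  have hcPd := hcardW (S ∪ Pd)
  have hcT2 := hcardW (S ∪ T2)
  rw [hSPdCard] at hcPd
  rw [Finset.card_union_of_disjoint hST2, hT2Card] at hcT2
  push_cast at hcPd hcT2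
  rw [hlast]
  have hN0 : (0 : ℝ) ≤ N := Nat.cast_nonneg N
  have hmid : condEnt (Fintype.card F) p (A D ⟨0, hN⟩)
        (fun ω => (Qall ω, (fun i : ↥(S ∪ Pd) => W i.val ω)))
      ≤ N * condEnt (Fintype.card F) p (A D ⟨0, hN⟩)
        (fun ω => (Qall ω, (fun i : ↥S => W i.val ω))) - P * L := by
    simp only [condEnt] at *
    linarith
  have hmul := mul_le_mul_of_nonneg_left hmid hN0
  have hfin : P * L + condEnt (Fintype.card F) p (A ⟨P2, hP2Mem⟩ ⟨0, hN⟩)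
        (fun ω => (Qall ω, (fun i : ↥(S ∪ T2) => W i.val ω)))
      ≤ N * condEnt (Fintype.card F) p (A D ⟨0, hN⟩)
        (fun ω => (Qall ω, (fun i : ↥(S ∪ Pd) => W i.val ω))) := by
    simp only [condEnt] at *
    linarith
  linarith
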